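/- Let (u_j^n) solve the explicit scheme (u_j^{n+1} − u_j^n)/Δt + D_−F(u_j^n, u_{j+1}^n) = D_−D_+A(u_j^n) for n ≥ 0, j ∈ ℤ, where F(u,v) = F₁(u) + F₂(v) is a monotone split flux, and suppose the CFL-type condition 1 − (Δt/Δx)(F₁'(z) − F₂'(z)) ≥ 0 holds for all z ∈ ℝ. Then for every constant c ∈ ℝ, every ε > 0 and all j, n: (ψ_ε(u_j^{n+1},c) − ψ_ε(u_j^n,c))/Δt + D_− Q^c(u_j^n, u_{j+1}^n) − D_−D_+ |A(u_j^n) − A(c)|_ε ≤ − (1/Δx²) ∫_{u_{j−1}^n}^{u_j^n} ψ_ε''(z,c)(A(z) − A(u_{j−1}^n)) dz − (1/Δx²) ∫_{u_{j+1}^n}^{u_j^n} ψ_ε''(z,c)(A(z) − A(u_{j+1}^n)) dz + ( ∫_{u_j^n}^{u_j^{n+1}} ψ_ε''(z,c) dz ) · D_−D_+ A(u_j^n), where Q^c(u,v) = ∫_c^u ψ_ε'(z,c) F₁'(z) dz + ∫_c^v ψ_ε'(z,c) F₂'(z) dz. -/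

import Mathlib

open MeasureTheory

/-- The Lipschitz approximation of the sign function. -/
noncomputable def signe (ε σ : ℝ) : ℝ :=
  if |σ| < ε then Real.sin (Real.pi * σ / (2 * ε)) else Real.sign σ

/-- `|u|_ε = ∫₀ᵘ sign_ε(z) dz`. -/
noncomputable def abse (ε u : ℝ) : ℝ := ∫ z in (0:ℝ)..u, signe ε z

/-- The entropy `ψ_ε(u,c) = ∫_c^u sign_ε(A(z) − A(c)) dz`. -/
noncomputable def psie (A : ℝ → ℝ) (ε u c : ℝ) : ℝ :=
  ∫ z in c..u, signe ε (A z - A c)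

/-- `ψ_ε''(z,c) = sign_ε'(A(z) − A(c)) A'(z)`. -/
noncomputable def psie'' (A : ℝ → ℝ) (ε z c : ℝ) : ℝ :=
  deriv (signe ε) (A z - A c) * deriv A z

/-- The numerical entropy flux
`Q^c(a,b) = ∫_c^a ψ_ε'(z,c) F₁'(z) dz + ∫_c^b ψ_ε'(z,c) F₂'(z) dz`. -/
noncomputable def QQ (A F₁ F₂ : ℝ → ℝ) (ε c a b : ℝ) : ℝ :=
  (∫ z in c..a, signe ε (A z - A c) * deriv F₁ z)
    + (∫ z in c..b, signe ε (A z - A c) * deriv F₂ z)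

/-- The derivative of `signe ε`, written with the projection of `σ` onto `[-ε, ε]`. -/
noncomputable def signeDeriv (ε σ : ℝ) : ℝ :=
  Real.pi / (2 * ε) * Real.cos (Real.pi * max (-ε) (min ε σ) / (2 * ε))

lemma continuous_signeDeriv (ε : ℝ) : Continuous (signeDeriv ε) := by
  unfold signeDeriv
  fun_prop

lemma signeDeriv_nonneg {ε : ℝ} (hε : 0 < ε) (σ : ℝ) : 0 ≤ signeDeriv ε σ := by
  have h1 : -ε ≤ max (-ε) (min ε σ) := le_max_left _ _
  have h2 : max (-ε) (min ε σ) ≤ ε := max_le (by linarith) (min_le_left _ _)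
  have hpi := Real.pi_pos
  refine mul_nonneg (by positivity) (Real.cos_nonneg_of_mem_Icc ⟨?_, ?_⟩)
  · rw [le_div_iff₀ (by positivity)]
    nlinarith
  · rw [div_le_iff₀ (by positivity)]
    nlinarith

lemma signe_eq_neg_one {ε σ : ℝ} (hε : 0 < ε) (h : σ ≤ -ε) : signe ε σ = -1 := by
  have h' : ¬ |σ| < ε := by
    rw [abs_of_neg (by linarith)]
    linarith
  rw [signe, if_neg h', Real.sign_of_neg (by linarith)]

lemma signe_eq_one {ε σ : ℝ} (hε : 0 < ε) (h : ε ≤ σ) : signe ε σ = 1 := by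
  have h' : ¬ |σ| < ε := by
    rw [abs_of_pos (by linarith)]
    linarith
  rw [signe, if_neg h', Real.sign_of_pos (by linarith)]

lemma signe_eq_sin {ε σ : ℝ} (hε : 0 < ε) (h : σ ∈ Set.Icc (-ε) ε) :
    signe ε σ = Real.sin (Real.pi * σ / (2 * ε)) := by
  rcases h.1.eq_or_lt with h1 | h1
  · rw [signe_eq_neg_one hε h1.ge, ← h1, show Real.pi * -ε / (2 * ε) = -(Real.pi / 2) by
      field_simp, Real.sin_neg, Real.sin_pi_div_two]
  rcases h.2.eq_or_lt with h2 | h2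
  · rw [signe_eq_one hε h2.ge, h2, show Real.pi * ε / (2 * ε) = Real.pi / 2 by
      field_simp, Real.sin_pi_div_two]
  · rw [signe, if_pos (abs_lt.2 ⟨h1, h2⟩)]

lemma signeDeriv_eq_zero_of_le {ε σ : ℝ} (hε : 0 < ε) (h : σ ≤ -ε) : signeDeriv ε σ = 0 := by
  rw [signeDeriv, min_eq_right (by linarith), max_eq_left h,
    show Real.pi * -ε / (2 * ε) = -(Real.pi / 2) by field_simp, Real.cos_neg,
    Real.cos_pi_div_two, mul_zero]

lemma signeDeriv_eq_zero_of_ge {ε σ : ℝ} (hε : 0 < ε) (h : ε ≤ σ) : signeDeriv ε σ = 0 := by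
  rw [signeDeriv, min_eq_left h, max_eq_right (by linarith),
    show Real.pi * ε / (2 * ε) = Real.pi / 2 by field_simp, Real.cos_pi_div_two, mul_zero]

lemma hasDerivAt_signe {ε : ℝ} (hε : 0 < ε) (σ : ℝ) :
    HasDerivAt (signe ε) (signeDeriv ε σ) σ := by
  have hl : HasDerivWithinAt (signe ε) (signeDeriv ε σ) (Set.Iic (-ε)) σ := by
    by_cases h : σ ∈ Set.Iic (-ε)
    · rw [signeDeriv_eq_zero_of_le hε h]
      exact (hasDerivWithinAt_const σ _ (-1)).congr_of_mem (fun x hx => signe_eq_neg_one hε hx) h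
    · exact HasFDerivWithinAt.of_notMem_closure (by rwa [isClosed_Iic.closure_eq])
  have hr : HasDerivWithinAt (signe ε) (signeDeriv ε σ) (Set.Ici ε) σ := by
    by_cases h : σ ∈ Set.Ici ε
    · rw [signeDeriv_eq_zero_of_ge hε h]
      exact (hasDerivWithinAt_const σ _ 1).congr_of_mem (fun x hx => signe_eq_one hε hx) h
    · exact HasFDerivWithinAt.of_notMem_closure (by rwa [isClosed_Ici.closure_eq])
  have hm : HasDerivWithinAt (signe ε) (signeDeriv ε σ) (Set.Icc (-ε) ε) σ := by
    by_cases h : σ ∈ Set.Icc (-ε) ε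
    · refine HasDerivWithinAt.congr_of_mem ?_ (fun x hx => signe_eq_sin hε hx) h
      rw [signeDeriv, min_eq_right h.2, max_eq_right h.1]
      have := (((hasDerivAt_id' σ).const_mul Real.pi).div_const (2 * ε)).sin
      exact (this.congr_deriv (by ring)).hasDerivWithinAt
    · exact HasFDerivWithinAt.of_notMem_closure (by rwa [isClosed_Icc.closure_eq])
  rw [← hasDerivWithinAt_univ]
  refine ((hl.union hm).union hr).mono fun x _ => ?_
  by_cases h1 : x ≤ -ε
  · exact Or.inl (Or.inl h1)
  by_cases h2 : ε ≤ x
  · exact Or.inr h2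
  · exact Or.inl (Or.inr ⟨by linarith, by linarith⟩)

lemma continuous_signe {ε : ℝ} (hε : 0 < ε) : Continuous (signe ε) :=
  continuous_iff_continuousAt.2 fun x => (hasDerivAt_signe hε x).continuousAt

lemma monotone_signe {ε : ℝ} (hε : 0 < ε) : Monotone (signe ε) :=
  monotone_of_deriv_nonneg (fun x => (hasDerivAt_signe hε x).differentiableAt) fun x => by
    rw [(hasDerivAt_signe hε x).deriv]
    exact signeDeriv_nonneg hε x

lemma psie''_eq {ε : ℝ} (hε : 0 < ε) (A : ℝ → ℝ) (z c : ℝ) :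
    psie'' A ε z c = signeDeriv ε (A z - A c) * deriv A z := by
  rw [psie'', (hasDerivAt_signe hε _).deriv]

lemma continuous_psie'' {A : ℝ → ℝ} {ε : ℝ} (hA : ContDiff ℝ 1 A) (hε : 0 < ε) (c : ℝ) :
    Continuous fun z => psie'' A ε z c := by
  simp_rw [psie''_eq hε]
  exact ((continuous_signeDeriv ε).comp (hA.continuous.sub continuous_const)).mul
    hA.continuous_deriv_one

lemma hasDerivAt_signe_comp {A : ℝ → ℝ} {ε : ℝ} (hA : ContDiff ℝ 1 A) (hε : 0 < ε) (c z : ℝ) :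
    HasDerivAt (fun z => signe ε (A z - A c)) (psie'' A ε z c) z := by
  rw [psie''_eq hε]
  exact (hasDerivAt_signe hε _).comp z
    ((hA.differentiable one_ne_zero z).hasDerivAt.sub_const (A c))

lemma abse_sub_eq_integral {A : ℝ → ℝ} {ε : ℝ} (hA : ContDiff ℝ 1 A) (hε : 0 < ε) (c x y : ℝ) :
    abse ε (A y - A c) - abse ε (A x - A c)
      = ∫ z in x..y, signe ε (A z - A c) * deriv A z := by
  have hi : ∀ a b, IntervalIntegrable (signe ε) volume a b :=
    fun a b => (continuous_signe hε).intervalIntegrable a b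
  rw [abse, abse, intervalIntegral.integral_interval_sub_left (hi _ _) (hi _ _)]
  exact (intervalIntegral.integral_comp_mul_deriv
    (fun z _ => (hA.differentiable one_ne_zero z).hasDerivAt.sub_const (A c))
    hA.continuous_deriv_one.continuousOn (continuous_signe hε)).symm

/-- Discrete chain rule for `|A(·) - A(c)|_ε`. -/
lemma abse_sub_abse {A : ℝ → ℝ} {ε : ℝ} (hA : ContDiff ℝ 1 A) (hε : 0 < ε) (c x y : ℝ) :
    abse ε (A x - A c) - abse ε (A y - A c)
      = signe ε (A y - A c) * (A x - A y) + ∫ z in x..y, psie'' A ε z c * (A z - A x) := by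
  have h := intervalIntegral.integral_mul_deriv_eq_deriv_mul (a := x) (b := y)
    (fun z _ => hasDerivAt_signe_comp hA hε c z)
    (fun z _ => (hA.differentiable one_ne_zero z).hasDerivAt.sub_const (A x))
    ((continuous_psie'' hA hε c).intervalIntegrable _ _)
    (hA.continuous_deriv_one.intervalIntegrable _ _)
  rw [← abse_sub_eq_integral hA hε] at h
  linear_combination -h

lemma integral_mul_nonpos_of_monotone {S g : ℝ → ℝ} (hS : Monotone S) (hg : ∀ z, 0 ≤ g z)
    (x w : ℝ) : ∫ z in x..w, (S z - S w) * g z ≤ 0 := by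
  rcases le_total x w with h | h
  · rw [← neg_nonneg, ← intervalIntegral.integral_neg]
    exact intervalIntegral.integral_nonneg h fun z hz =>
      neg_nonneg.2 (mul_nonpos_of_nonpos_of_nonneg (sub_nonpos.2 (hS hz.2)) (hg z))
  · rw [intervalIntegral.integral_symm, neg_nonpos]
    exact intervalIntegral.integral_nonneg h fun z hz =>
      mul_nonneg (sub_nonneg.2 (hS hz.1)) (hg z)

lemma integral_mul_deriv_sub_const {S F : ℝ → ℝ} (hS : Continuous S) (hF : ContDiff ℝ 1 F)
    (k x y : ℝ) :
    ∫ z in x..y, (S z - k) * deriv F z = (∫ z in x..y, S z * deriv F z) - k * (F y - F x) := by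
  have hF' := hF.continuous_deriv_one
  have hSF : Continuous fun z => S z * deriv F z := hS.mul hF'
  simp_rw [sub_mul]
  rw [intervalIntegral.integral_sub (hSF.intervalIntegrable _ _)
    ((hF'.const_mul k).intervalIntegrable _ _), intervalIntegral.integral_const_mul,
    intervalIntegral.integral_deriv_eq_sub (fun z _ => hF.differentiable one_ne_zero z)
    (hF'.intervalIntegrable _ _)]

/-- The sign of the dissipation of a monotone scheme under the CFL condition. -/
lemma monotone_scheme_dissipation {Δx Δt : ℝ} (hΔx : 0 < Δx) (hΔt : 0 < Δt) {S F₁ F₂ : ℝ → ℝ}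
    (hS : Monotone S) (hSc : Continuous S) (hF₁ : ContDiff ℝ 1 F₁) (hF₂ : ContDiff ℝ 1 F₂)
    (hF₁' : ∀ z, 0 ≤ deriv F₁ z) (hF₂' : ∀ z, deriv F₂ z ≤ 0)
    (hCFL : ∀ z : ℝ, 0 ≤ 1 - (Δt / Δx) * (deriv F₁ z - deriv F₂ z)) (a b d w : ℝ) :
    (∫ z in b..w, S z - S w) / Δt
      + ((∫ z in a..b, (S z - S w) * deriv F₁ z)
        + ∫ z in b..d, (S z - S w) * deriv F₂ z) / Δx ≤ 0 := by
  have hT : Continuous fun z => S z - S w := hSc.sub continuous_const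
  have h1 : ∀ x y, IntervalIntegrable (fun z => (S z - S w) * deriv F₁ z) volume x y :=
    fun x y => (hT.mul hF₁.continuous_deriv_one).intervalIntegrable x y
  have h2 : ∀ x y, IntervalIntegrable (fun z => (S z - S w) * deriv F₂ z) volume x y :=
    fun x y => (hT.mul hF₂.continuous_deriv_one).intervalIntegrable x y
  have e1 := intervalIntegral.integral_add_adjacent_intervals (h1 a b) (h1 b w)
  have e2 := intervalIntegral.integral_add_adjacent_intervals (h2 b d) (h2 d w)
  have n1 := integral_mul_nonpos_of_monotone hS hF₁' a w
  have n2 := integral_mul_nonpos_of_monotone hS (fun z => neg_nonneg.2 (hF₂' z)) d w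
  have n3 := integral_mul_nonpos_of_monotone hS hCFL b w
  have e3 : ∫ z in b..w, (S z - S w) * (1 - (Δt / Δx) * (deriv F₁ z - deriv F₂ z))
      = (∫ z in b..w, S z - S w) - Δt / Δx * ((∫ z in b..w, (S z - S w) * deriv F₁ z)
        - ∫ z in b..w, (S z - S w) * deriv F₂ z) := by
    rw [← intervalIntegral.integral_sub (h1 b w) (h2 b w),
      ← intervalIntegral.integral_const_mul, ← intervalIntegral.integral_sub
      (hT.intervalIntegrable _ _) (((h1 b w).sub (h2 b w)).const_mul _)]
    congr 1 with z
    ring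
  simp_rw [mul_neg] at n2
  rw [intervalIntegral.integral_neg] at n2
  have key : (∫ z in b..w, S z - S w) / Δt
      + ((∫ z in a..b, (S z - S w) * deriv F₁ z)
        + ∫ z in b..d, (S z - S w) * deriv F₂ z) / Δx
      = (∫ z in b..w, (S z - S w) * (1 - (Δt / Δx) * (deriv F₁ z - deriv F₂ z))) / Δt
        + ((∫ z in a..w, (S z - S w) * deriv F₁ z)
          + -∫ z in d..w, (S z - S w) * deriv F₂ z) / Δx := by
    rw [e3, ← e1, ← e2]
    field_simp
    ring
  rw [key]
  exact add_nonpos (div_nonpos_of_nonpos_of_nonneg n3 hΔt.le)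
    (div_nonpos_of_nonpos_of_nonneg (add_nonpos n1 n2) hΔx.le)

/-- the discrete entropy inequality for the explicit scheme
(Lemma `lemma:EntropyCalcDiscExpl`) under the CFL-type condition
`1 − (Δt/Δx)(F₁'(z) − F₂'(z)) ≥ 0`. -/
theorem stmt_19 (Δx Δt : ℝ) (hΔx : 0 < Δx) (hΔt : 0 < Δt)
    (f A F₁ F₂ : ℝ → ℝ)
    (hf : ContDiff ℝ 1 f) (hA : ContDiff ℝ 1 A) (hA' : ∀ z, 0 ≤ deriv A z)
    (hF₁ : ContDiff ℝ 1 F₁) (hF₂ : ContDiff ℝ 1 F₂)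
    (hF₁' : ∀ z, 0 ≤ deriv F₁ z) (hF₂' : ∀ z, deriv F₂ z ≤ 0)
    (hsum : ∀ z, deriv F₁ z + deriv F₂ z = deriv f z)
    (u : ℕ → ℤ → ℝ)
    (hscheme : ∀ (n : ℕ) (j : ℤ),
      (u (n+1) j - u n j) / Δt
        + ((F₁ (u n j) + F₂ (u n (j+1))) - (F₁ (u n (j-1)) + F₂ (u n j))) / Δx
      = (A (u n (j+1)) - 2 * A (u n j) + A (u n (j-1))) / Δx ^ 2)
    (hCFL : ∀ z : ℝ, 0 ≤ 1 - (Δt / Δx) * (deriv F₁ z - deriv F₂ z))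
    (c ε : ℝ) (hε : 0 < ε) :
    ∀ (n : ℕ) (j : ℤ),
      (psie A ε (u (n+1) j) c - psie A ε (u n j) c) / Δt
        + (QQ A F₁ F₂ ε c (u n j) (u n (j+1)) - QQ A F₁ F₂ ε c (u n (j-1)) (u n j)) / Δx
        - (abse ε (A (u n (j+1)) - A c) - 2 * abse ε (A (u n j) - A c)
            + abse ε (A (u n (j-1)) - A c)) / Δx ^ 2
      ≤ -(1 / Δx ^ 2) * (∫ z in (u n (j-1))..(u n j), psie'' A ε z c * (A z - A (u n (j-1))))
        - (1 / Δx ^ 2) * (∫ z in (u n (j+1))..(u n j), psie'' A ε z c * (A z - A (u n (j+1))))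
        + (∫ z in (u n j)..(u (n+1) j), psie'' A ε z c)
            * ((A (u n (j+1)) - 2 * A (u n j) + A (u n (j-1))) / Δx ^ 2) := by
  intro n j
  have hs := hscheme n j
  generalize u (n + 1) j = w at *
  generalize u n (j - 1) = a at *
  generalize u n (j + 1) = d at *
  generalize u n j = b at *
  have hSc : Continuous fun z => signe ε (A z - A c) :=
    (continuous_signe hε).comp (hA.continuous.sub continuous_const)
  have hSm : Monotone fun z => signe ε (A z - A c) := fun x y hxy =>
    monotone_signe hε (sub_le_sub_right
      (monotone_of_deriv_nonneg (hA.differentiable one_ne_zero) hA' hxy) _)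
  have hdiss := monotone_scheme_dissipation hΔx hΔt hSm hSc hF₁ hF₂ hF₁' hF₂' hCFL a b d w
  rw [integral_mul_deriv_sub_const hSc hF₁, integral_mul_deriv_sub_const hSc hF₂,
    intervalIntegral.integral_sub (hSc.intervalIntegrable _ _) (by simp),
    intervalIntegral.integral_const, smul_eq_mul] at hdiss
  have hψ : psie A ε w c - psie A ε b c = ∫ z in b..w, signe ε (A z - A c) :=
    intervalIntegral.integral_interval_sub_left (hSc.intervalIntegrable _ _)
      (hSc.intervalIntegrable _ _)
  have hQ : ∀ F : ℝ → ℝ, ContDiff ℝ 1 F → ∀ x y,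
      (∫ z in c..y, signe ε (A z - A c) * deriv F z)
        - (∫ z in c..x, signe ε (A z - A c) * deriv F z)
      = ∫ z in x..y, signe ε (A z - A c) * deriv F z := fun F hF x y =>
    intervalIntegral.integral_interval_sub_left
      ((hSc.mul hF.continuous_deriv_one).intervalIntegrable _ _)
      ((hSc.mul hF.continuous_deriv_one).intervalIntegrable _ _)
  have hI : ∫ z in b..w, psie'' A ε z c = signe ε (A w - A c) - signe ε (A b - A c) :=
    intervalIntegral.integral_eq_sub_of_hasDerivAt
      (fun z _ => hasDerivAt_signe_comp hA hε c z)
      ((continuous_psie'' hA hε c).intervalIntegrable _ _)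
  rw [← hψ, ← hQ F₁ hF₁, ← hQ F₂ hF₂] at hdiss
  rw [hI, QQ, QQ]
  have ga := abse_sub_abse hA hε c a b
  have gd := abse_sub_abse hA hε c d b
  rw [← sub_nonpos]
  refine le_of_eq_of_le ?_ hdiss
  linear_combination (-(1 / Δx ^ 2)) * ga - (1 / Δx ^ 2) * gd
    + signe ε (A w - A c) * hs
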